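/- Theta transformation formula for a Gram matrix (general quadratic form version indicated in Remark 4.2): let d ≥ 1 and let S be a real symmetric positive definite d×d matrix. Then for every z ∈ ℂ with Im z > 0: ∑_{m∈ℤ^d} exp(πi·z·mᵀS m) = (−iz)^{−d/2} · (det S)^{−1/2} · ∑_{k∈ℤ^d} exp(πi·(−z⁻¹)·kᵀS⁻¹k). -/

import Mathlib

open Matrix

open MeasureTheory TopologicalSpace Topology in
/-- **Poisson summation** on `ℤ^ι`, evaluated at the origin. -/
theorem tsum_eq_tsum_integral_cexp_of_summable_norm_restrict {ι : Type*} [Fintype ι]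
    {f : C(ι → ℝ, ℂ)} (hfi : Integrable f)
    (hf : ∀ K : Compacts (ι → ℝ), Summable fun n : ι → ℤ ↦
      ‖(f.comp (ContinuousMap.addRight fun i ↦ (n i : ℝ))).restrict K‖)
    (hsum : Summable fun k : ι → ℤ ↦
      ∫ x : ι → ℝ, Complex.exp (-(2 * Real.pi * Complex.I) * ∑ i, k i * (x i : ℂ)) * f x) :
    ∑' n : ι → ℤ, f (fun i ↦ (n i : ℝ)) = ∑' k : ι → ℤ,
      ∫ x : ι → ℝ, Complex.exp (-(2 * Real.pi * Complex.I) * ∑ i, k i * (x i : ℂ)) * f x := by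
  have hs := ContinuousMap.summable_of_locally_summable_norm hf
  set G : C(ι → ℝ, ℂ) := ∑' n : ι → ℤ, f.comp (ContinuousMap.addRight fun i ↦ (n i : ℝ))
  have hGx (x : ι → ℝ) : HasSum (fun n : ι → ℤ ↦ f (fun i ↦ x i + n i)) (G x) :=
    ContinuousMap.hasSum_apply hs.hasSum x
  let p : C(ι → ℝ, UnitAddTorus ι) := ⟨fun x i ↦ (x i : UnitAddCircle), by fun_prop⟩
  have hp : IsQuotientMap p := by
    have : IsOpenQuotientMap (Pi.map fun (_ : ι) (x : ℝ) ↦ (x : UnitAddCircle)) :=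
      .piMap fun _ ↦ QuotientAddGroup.isOpenQuotientMap_mk
    exact this.isQuotientMap
  have hper : ∀ x y, p x = p y → G x = G y := by
    intro x y hxy
    have : ∀ i, ∃ m : ℤ, x i = y i + m := fun i ↦ by
      have := congrFun hxy i
      obtain ⟨m, hm⟩ := (AddCircle.coe_eq_zero_iff (1 : ℝ)).mp
        ((AddCircle.coe_sub 1 (x i) (y i)).trans (sub_eq_zero.mpr this))
      exact ⟨m, by simp at hm; linarith⟩
    choose m hm using this
    have h := (Equiv.addLeft m).hasSum_iff.mpr (hGx y)
    refine (hGx x).unique ?_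
    convert! h using 2 with n
    simp [hm, add_assoc]
  let F : C(UnitAddTorus ι, ℂ) := hp.lift G hper
  have hF (x : ι → ℝ) : F (fun i ↦ (x i : UnitAddCircle)) = G x :=
    DFunLike.congr_fun (hp.lift_comp G hper) x
  have hcoeff (k : ι → ℤ) : UnitAddTorus.mFourierCoeff F k =
      ∫ x : ι → ℝ, Complex.exp (-(2 * Real.pi * Complex.I) * ∑ i, k i * (x i : ℂ)) * f x := by
    set e : (ι → ℝ) → ℂ := fun x ↦
      Complex.exp (-(2 * Real.pi * Complex.I) * ∑ i, k i * (x i : ℂ)) with he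
    have he_cont : Continuous e := by fun_prop
    have he_norm (x : ι → ℝ) : ‖e x‖ = 1 := by
      rw [← Complex.norm_exp_ofReal_mul_I (-(2 * Real.pi) * ∑ i, k i * x i), he]
      push_cast
      ring_nf
    have he_per (x : ι → ℝ) (n : ι → ℤ) : e (x + fun i ↦ (n i : ℝ)) = e x := by
      refine Complex.exp_eq_exp_iff_exists_int.mpr ⟨-∑ i, k i * n i, ?_⟩
      simp [mul_add, Finset.sum_add_distrib]
      ring
    have hfe : Integrable fun x ↦ e x * f x :=
      hfi.bdd_mul he_cont.aestronglyMeasurable (.of_forall fun x ↦ (he_norm x).le)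
    let B (n : ι → ℤ) : Set (ι → ℝ) := {x | ∀ i, x i - n i ∈ Set.Ioc 0 1}
    have hB_meas (n : ι → ℤ) : MeasurableSet (B n) := by
      have : B n = ⋂ i, (fun x : ι → ℝ ↦ x i - n i) ⁻¹' Set.Ioc 0 1 := by
        ext; simp [B]
      rw [this]
      exact .iInter fun i ↦ (by fun_prop : Measurable _) measurableSet_Ioc
    have hB_disj : Pairwise (Function.onFun Disjoint B) := by
      intro m n hmn
      refine Set.disjoint_left.mpr fun x hm hn ↦ hmn (funext fun i ↦ ?_)
      have h1 := hm i
      have h2 := hn i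
      simp only [Set.mem_Ioc] at h1 h2
      have h3 : (m i : ℝ) < n i + 1 := by linarith
      have h4 : (n i : ℝ) < m i + 1 := by linarith
      norm_cast at h3 h4
      omega
    have hB_univ : ⋃ n, B n = Set.univ := by
      refine Set.eq_univ_of_forall fun x ↦ Set.mem_iUnion.mpr ⟨fun i ↦ ⌈x i⌉ - 1, fun i ↦ ?_⟩
      have := Int.le_ceil (x i)
      have := Int.ceil_lt_add_one (x i)
      constructor <;> push_cast <;> linarith
    let K : Compacts (ι → ℝ) := ⟨Set.Icc 0 1, isCompact_Icc⟩
    have hBK : B 0 ⊆ K := fun x hx ↦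
      ⟨fun i ↦ by simpa using (hx i).1.le, fun i ↦ by simpa using (hx i).2⟩
    have hB_fin : volume (B 0) < ⊤ := (measure_mono hBK).trans_lt K.isCompact.measure_lt_top
    have hint (n : ι → ℤ) :
        IntegrableOn (fun x ↦ e x * f (x + fun i ↦ (n i : ℝ))) (B 0) :=
      (Continuous.continuousOn (by fun_prop)).integrableOn_compact K.isCompact |>.mono_set hBK
    have hswap : HasSum (fun n : ι → ℤ ↦ ∫ x in B 0, e x * f (x + fun i ↦ (n i : ℝ)))
        (∫ x in B 0, ∑' n : ι → ℤ, e x * f (x + fun i ↦ (n i : ℝ))) := by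
      refine hasSum_integral_of_summable_integral_norm hint ?_
      refine .of_nonneg_of_le (fun n ↦ integral_nonneg fun _ ↦ norm_nonneg _) (fun n ↦ ?_)
        ((hf K).mul_left (volume.real (B 0)))
      rw [← smul_eq_mul, ← setIntegral_const]
      refine setIntegral_mono_on (hint n).norm (integrableOn_const hB_fin.ne) (hB_meas 0)
        fun x hx ↦ ?_
      rw [norm_mul, he_norm, one_mul]
      exact ((f.comp (ContinuousMap.addRight fun i ↦ (n i : ℝ))).restrict K).norm_coe_le_norm
        ⟨x, hBK hx⟩
    have hunion := hasSum_integral_iUnion hB_meas hB_disj hfe.integrableOn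
    rw [hB_univ, setIntegral_univ] at hunion
    refine Eq.trans ?_ (hswap.unique ?_)
    · rw [UnitAddTorus.mFourierCoeff_eq_integral _ _ 0]
      have : {x : ι → ℝ | ∀ i, x i ∈ Set.Ioc ((0 : ι → ℝ) i) ((0 : ι → ℝ) i + 1)} = B 0 := by
        simp [B]
      rw [this]
      congr 1 with x
      rw [hF, ← (hGx x).tsum_eq, tsum_mul_left, smul_eq_mul]
      congr 1
      simp only [UnitAddTorus.mFourier, ContinuousMap.coe_mk, fourier_coe_apply, he,
        ← Complex.exp_sum, Finset.mul_sum]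
      congr 2 with i
      simp
      ring
    · convert! hunion using 2 with n
      have hB : (fun x ↦ x + fun i ↦ (n i : ℝ)) ⁻¹' B n = B 0 := by
        ext; simp [B]
      have h := (measurePreserving_add_right volume fun i ↦ (n i : ℝ)).setIntegral_preimage_emb
        (measurableEmbedding_addRight _) (fun x ↦ e x * f x) (B n)
      simpa only [hB, he_per] using h
  have h := UnitAddTorus.hasSum_mFourier_series_apply_of_summable (f := F)
    (by simpa only [funext hcoeff] using hsum) (fun i ↦ ((0 : ℝ) : UnitAddCircle))
  have h0 := hF 0
  simp only [Pi.zero_apply] at h0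
  rw [h0] at h
  have h1 := (hGx 0).tsum_eq
  simp only [Pi.zero_apply, zero_add] at h1
  rw [h1, ← h.tsum_eq]
  simp [hcoeff, UnitAddTorus.mFourier]

/-- Products of summable families are summable over functions `Fin d → α`. -/
theorem summable_prod_fin_of_nonneg {α : Type*} {g : α → ℝ} (hg : Summable g) (h0 : 0 ≤ g) (d : ℕ) :
    Summable fun n : Fin d → α ↦ ∏ i, g (n i) := by
  induction d with
  | zero => exact (hasSum_fintype _).summable
  | succ d ih =>
    rw [← (Fin.consEquiv fun _ ↦ α).summable_iff]
    convert hg.mul_of_nonneg ih h0 fun n ↦ Finset.prod_nonneg fun i _ ↦ h0 _ using 2 with x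
    simp [Fin.prod_univ_succ]

theorem summable_exp_neg_mul_sum_sq {a : ℝ} (ha : 0 < a) (d : ℕ) :
    Summable fun n : Fin d → ℤ ↦ Real.exp (-a * ∑ i, (n i : ℝ) ^ 2) := by
  have h : Summable fun n : ℤ ↦ Real.exp (-a * (n : ℝ) ^ 2) := by
    have := (summable_jacobiTheta₂_term_iff 0 (a / Real.pi * Complex.I)).mpr (by
      simp; positivity)
    convert this.norm using 2 with n
    rw [norm_jacobiTheta₂_term]
    congr 1
    have := Real.pi_ne_zero
    simp
    field_simp
  simpa only [Finset.mul_sum, Real.exp_sum] using summable_prod_fin_of_nonneg h (fun _ ↦ by positivity) d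

/-- A positive definite real form dominates a multiple of the sum of squares. -/
theorem Matrix.exists_pos_mul_sum_sq_le {ι : Type*} [Fintype ι] [DecidableEq ι]
    {A : Matrix ι ι ℝ} (hA : IsUnit A) :
    ∃ c > 0, ∀ v : ι → ℝ, c * ∑ i, v i ^ 2 ≤ ∑ i, (A *ᵥ v) i ^ 2 := by
  set C := ∑ i, ∑ j, A⁻¹ i j ^ 2
  have hC : 0 ≤ C := by positivity
  refine ⟨(C + 1)⁻¹, by positivity, fun v ↦ ?_⟩
  rw [inv_mul_le_iff₀ (by positivity)]
  calc ∑ i, v i ^ 2 = ∑ i, (∑ j, A⁻¹ i j * (A *ᵥ v) j) ^ 2 := by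
        have : A⁻¹ *ᵥ (A *ᵥ v) = v := by
          rw [mulVec_mulVec, nonsing_inv_mul _ ((isUnit_iff_isUnit_det _).mp hA), one_mulVec]
        exact Finset.sum_congr rfl fun i _ ↦ by rw [← congrFun this i]; rfl
    _ ≤ ∑ i, (∑ j, A⁻¹ i j ^ 2) * ∑ j, (A *ᵥ v) j ^ 2 :=
        Finset.sum_le_sum fun i _ ↦ Finset.sum_mul_sq_le_sq_mul_sq _ _ _
    _ = C * ∑ j, (A *ᵥ v) j ^ 2 := by rw [← Finset.sum_mul]
    _ ≤ _ := by gcongr; linarith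

theorem Matrix.dotProduct_transpose_mul_self_mulVec {ι : Type*} [Fintype ι]
    (A : Matrix ι ι ℝ) (v : ι → ℝ) : v ⬝ᵥ (Aᵀ * A) *ᵥ v = ∑ i, (A *ᵥ v) i ^ 2 := by
  rw [← mulVec_mulVec, dotProduct_mulVec, vecMul_transpose]
  simp [dotProduct, sq]

theorem Complex.exists_norm_cexp_neg_mul_sum_mulVec_add_sq_le {ι : Type*} [Fintype ι]
    [DecidableEq ι] {A : Matrix ι ι ℝ} (hA : IsUnit A) {b : ℂ} (hb : 0 < b.re) :
    ∃ a > 0, ∀ x v : ι → ℝ, ‖Complex.exp (-b * ((∑ i, (A *ᵥ (x + v)) i ^ 2 : ℝ) : ℂ))‖ ≤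
      Real.exp (2 * a * ∑ i, x i ^ 2) * Real.exp (-a * ∑ i, v i ^ 2) := by
  obtain ⟨c, hc, h⟩ := Matrix.exists_pos_mul_sum_sq_le hA
  refine ⟨b.re * c / 2, by positivity, fun x v ↦ ?_⟩
  rw [Complex.norm_exp, ← Real.exp_add, Real.exp_le_exp, Complex.re_mul_ofReal, Complex.neg_re]
  have h1 : ∑ i, v i ^ 2 / 2 - ∑ i, x i ^ 2 ≤ ∑ i, (x + v) i ^ 2 := by
    rw [← Finset.sum_sub_distrib]
    refine Finset.sum_le_sum fun i _ ↦ ?_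
    rw [Pi.add_apply]
    nlinarith [sq_nonneg (2 * x i + v i)]
  rw [← Finset.sum_div] at h1
  have h2 := mul_le_mul_of_nonneg_left (h (x + v)) hb.le
  have h3 := mul_le_mul_of_nonneg_left h1 (mul_pos hb hc).le
  linarith

theorem Complex.summable_cexp_neg_mul_sum_mulVec_sq {d : ℕ} {A : Matrix (Fin d) (Fin d) ℝ}
    (hA : IsUnit A) {b : ℂ} (hb : 0 < b.re) :
    Summable fun n : Fin d → ℤ ↦
      Complex.exp (-b * ((∑ i, (A *ᵥ fun i ↦ (n i : ℝ)) i ^ 2 : ℝ) : ℂ)) := by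
  obtain ⟨a, ha, h⟩ := exists_norm_cexp_neg_mul_sum_mulVec_add_sq_le hA hb
  refine (summable_exp_neg_mul_sum_sq ha d).of_norm_bounded fun n ↦ ?_
  simpa using h 0 fun i ↦ (n i : ℝ)

open MeasureTheory in
theorem MeasureTheory.integrable_comp_mulVec {ι E : Type*} [Fintype ι] [DecidableEq ι]
    [NormedAddCommGroup E] {A : Matrix ι ι ℝ} (hA : IsUnit A) {g : (ι → ℝ) → E}
    (hg : Integrable g) : Integrable fun x ↦ g (A *ᵥ x) := by
  have hdet : A.det ≠ 0 := ((isUnit_iff_isUnit_det A).mp hA).ne_zero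
  have h := Real.map_matrix_volume_pi_eq_smul_volume_pi hdet
  have hcont : Continuous (toLin' A) := (toLin' A).continuous_of_finiteDimensional
  have hg' : Integrable g (Measure.map (toLin' A) volume) := by
    rw [h]; exact hg.smul_measure ENNReal.ofReal_ne_top
  exact hg'.comp_measurable hcont.measurable

open MeasureTheory in
theorem MeasureTheory.integral_comp_mulVec {ι E : Type*} [Fintype ι] [DecidableEq ι]
    [NormedAddCommGroup E] [NormedSpace ℝ E] {A : Matrix ι ι ℝ} (hA : IsUnit A)
    {g : (ι → ℝ) → E} (hg : AEStronglyMeasurable g) :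
    ∫ x, g (A *ᵥ x) = |A.det|⁻¹ • ∫ x, g x := by
  have hdet : A.det ≠ 0 := ((isUnit_iff_isUnit_det A).mp hA).ne_zero
  have h := Real.map_matrix_volume_pi_eq_smul_volume_pi hdet
  have hcont : Continuous (toLin' A) := (toLin' A).continuous_of_finiteDimensional
  have := integral_map (μ := volume) (f := g) hcont.measurable.aemeasurable
    (by rw [h]; exact hg.smul_measure _)
  rw [h, integral_smul_measure, ENNReal.toReal_ofReal (abs_nonneg _), abs_inv] at this
  simpa using this.symm

open MeasureTheory in
/-- The Fourier transform of the Gaussian `exp (-b ‖A x‖²)`. -/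
theorem integral_cexp_mul_cexp_neg_mul_sum_mulVec_sq {ι : Type*} [Fintype ι] [DecidableEq ι]
    {A : Matrix ι ι ℝ} (hA : IsUnit A) {b : ℂ} (hb : 0 < b.re) (w : ι → ℝ) :
    ∫ x : ι → ℝ, Complex.exp (-(2 * Real.pi * Complex.I) * ∑ i, w i * (x i : ℂ)) *
        Complex.exp (-b * ((∑ i, (A *ᵥ x) i ^ 2 : ℝ) : ℂ)) =
      |A.det|⁻¹ * (Real.pi / b) ^ (Fintype.card ι / 2 : ℂ) *
        Complex.exp (-(Real.pi ^ 2 / b) * ((∑ i, (Aᵀ⁻¹ *ᵥ w) i ^ 2 : ℝ) : ℂ)) := by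
  have hdet := (isUnit_iff_isUnit_det A).mp hA
  set c : ι → ℂ := fun i ↦ -(2 * Real.pi * Complex.I) * ((Aᵀ⁻¹ *ᵥ w) i : ℝ) with hc
  have hdual (x : ι → ℝ) : ∑ i, (Aᵀ⁻¹ *ᵥ w) i * (A *ᵥ x) i = ∑ i, w i * x i := by
    change (Aᵀ⁻¹ *ᵥ w) ⬝ᵥ (A *ᵥ x) = w ⬝ᵥ x
    rw [← transpose_nonsing_inv, mulVec_transpose, ← dotProduct_mulVec, mulVec_mulVec,
      nonsing_inv_mul _ hdet, one_mulVec]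
  calc _ = ∫ x : ι → ℝ, (fun y : ι → ℝ ↦
          Complex.exp (-b * ∑ i, (y i : ℂ) ^ 2 + ∑ i, c i * y i)) (A *ᵥ x) := by
        congr 1 with x
        rw [← Complex.exp_add, add_comm]
        congr 2
        · push_cast; rfl
        · simp only [hc, mul_assoc (-(2 * Real.pi * Complex.I)), ← Finset.mul_sum]
          congr 1
          exact_mod_cast (hdual x).symm
    _ = _ := by
        rw [integral_comp_mulVec hA
            (g := fun y : ι → ℝ ↦ Complex.exp (-b * ∑ i, (y i : ℂ) ^ 2 + ∑ i, c i * y i))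
            (Continuous.aestronglyMeasurable (by fun_prop)),
          GaussianFourier.integral_cexp_neg_mul_sum_add hb, Complex.real_smul, mul_assoc]
        push_cast
        congr 3
        have hb0 : b ≠ 0 := by rintro rfl; simp at hb
        simp only [hc, mul_pow, ← Finset.mul_sum, neg_sq, Complex.I_sq]
        field_simp
        ring

theorem tsum_cexp_neg_mul_sum_mulVec_sq {d : ℕ} {A : Matrix (Fin d) (Fin d) ℝ}
    (hA : IsUnit A) {b : ℂ} (hb : 0 < b.re) :
    ∑' n : Fin d → ℤ, Complex.exp (-b * ((∑ i, (A *ᵥ fun i ↦ (n i : ℝ)) i ^ 2 : ℝ) : ℂ)) =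
      |A.det|⁻¹ * (Real.pi / b) ^ (d / 2 : ℂ) * ∑' k : Fin d → ℤ,
        Complex.exp (-(Real.pi ^ 2 / b) *
          ((∑ i, (Aᵀ⁻¹ *ᵥ fun i ↦ (k i : ℝ)) i ^ 2 : ℝ) : ℂ)) := by
  let f : C(Fin d → ℝ, ℂ) :=
    ⟨fun x ↦ Complex.exp (-b * ((∑ i, (A *ᵥ x) i ^ 2 : ℝ) : ℂ)), by fun_prop⟩
  have hfi : MeasureTheory.Integrable f := by
    have h := MeasureTheory.integrable_comp_mulVec hA
      (GaussianFourier.integrable_cexp_neg_mul_sum_add hb (0 : Fin d → ℂ))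
    convert! h using 2 with x
    simp [f]
  have hfourier (k : Fin d → ℤ) := integral_cexp_mul_cexp_neg_mul_sum_mulVec_sq hA hb
    fun i ↦ (k i : ℝ)
  simp only [Complex.ofReal_intCast, Fintype.card_fin] at hfourier
  have hA' : IsUnit Aᵀ⁻¹ := by simpa [isUnit_iff_isUnit_det] using hA
  have hb' : 0 < (Real.pi ^ 2 / b).re := by
    rw [← Complex.ofReal_pow, div_eq_mul_inv, Complex.re_ofReal_mul, Complex.inv_re]
    have : b ≠ 0 := by rintro rfl; simp at hb
    have := Complex.normSq_pos.mpr this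
    positivity
  have key := tsum_eq_tsum_integral_cexp_of_summable_norm_restrict hfi (fun K ↦ ?_) ?_
  · rw [← tsum_mul_left]
    simpa only [f, ContinuousMap.coe_mk, hfourier] using key
  · obtain ⟨a, ha, h⟩ := Complex.exists_norm_cexp_neg_mul_sum_mulVec_add_sq_le hA hb
    obtain ⟨C, hC⟩ := K.isCompact.exists_bound_of_continuousOn
      (f := fun x : Fin d → ℝ ↦ Real.exp (2 * a * ∑ i, x i ^ 2)) (by fun_prop)
    refine .of_nonneg_of_le (fun _ ↦ norm_nonneg _) (fun n ↦ ?_)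
      ((summable_exp_neg_mul_sum_sq ha d).mul_left |C|)
    refine (ContinuousMap.norm_le _ (by positivity)).mpr fun x ↦ (h x _).trans ?_
    gcongr
    exact (Real.le_norm_self _).trans ((hC x x.2).trans (le_abs_self C))
  · simpa only [f, ContinuousMap.coe_mk, hfourier] using
      (Complex.summable_cexp_neg_mul_sum_mulVec_sq hA' hb').mul_left _

open scoped MatrixOrder Matrix.Norms.L2Operator in
theorem Matrix.PosDef.exists_isUnit_eq_transpose_mul_self {ι : Type*} [Fintype ι] [DecidableEq ι]
    {S : Matrix ι ι ℝ} (hS : S.PosDef) : ∃ A : Matrix ι ι ℝ, IsUnit A ∧ S = Aᵀ * A := by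
  simpa [star_eq_conjTranspose] using
    CStarAlgebra.isStrictlyPositive_iff_eq_star_mul_self.mp hS.isStrictlyPositive

/-- **Theta transformation formula for a Gram matrix** (general quadratic form version
indicated in Remark 4.2): for `S` a real symmetric positive definite `d × d` matrix and
`z ∈ ℂ` with `Im z > 0`,
`∑_{m∈ℤ^d} exp(πiz·mᵀSm) = (−iz)^{−d/2} (det S)^{−1/2} ∑_{k∈ℤ^d} exp(πi(−z⁻¹)·kᵀS⁻¹k)`. -/
theorem theta_transformation_gram (d : ℕ) (hd : 1 ≤ d)
    (S : Matrix (Fin d) (Fin d) ℝ) (hS : S.PosDef) (hSym : S.IsSymm)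
    (z : ℂ) (hz : 0 < z.im) :
    ∑' m : Fin d → ℤ,
        Complex.exp ((Real.pi : ℂ) * Complex.I * z *
          (((fun i => (m i : ℝ)) ⬝ᵥ S.mulVec fun i => (m i : ℝ) : ℝ) : ℂ))
      = (-Complex.I * z) ^ (-(d : ℂ) / 2) * (S.det : ℂ) ^ (-(1 : ℂ) / 2) *
        ∑' k : Fin d → ℤ,
          Complex.exp ((Real.pi : ℂ) * Complex.I * (-z⁻¹) *
            (((fun i => (k i : ℝ)) ⬝ᵥ S⁻¹.mulVec fun i => (k i : ℝ) : ℝ) : ℂ)) := by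
  obtain ⟨A, hA, rfl⟩ := hS.exists_isUnit_eq_transpose_mul_self
  have hz0 : z ≠ 0 := by rintro rfl; simp at hz
  have hpi : (Real.pi : ℂ) ≠ 0 := mod_cast Real.pi_ne_zero
  have hb : 0 < (-(Real.pi * Complex.I * z)).re := by
    simpa [mul_assoc] using mul_pos Real.pi_pos hz
  have hinv : (Aᵀ * A)⁻¹ = Aᵀ⁻¹ᵀ * Aᵀ⁻¹ := by
    rw [Matrix.mul_inv_rev, transpose_nonsing_inv, transpose_transpose]
  have hdet : ((|A.det| : ℝ) : ℂ)⁻¹ = ((Aᵀ * A).det : ℂ) ^ (-(1 : ℂ) / 2) := by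
    rw [det_mul, det_transpose, ← abs_mul_abs_self,
      show (-(1 : ℂ) / 2) = ((-1 / 2 : ℝ) : ℂ) by norm_num,
      ← Complex.ofReal_cpow (by positivity), ← sq, ← Real.rpow_natCast,
      ← Real.rpow_mul (abs_nonneg _)]
    norm_num [Real.rpow_neg_one]
  have hpow : (Real.pi / -(Real.pi * Complex.I * z)) ^ (d / 2 : ℂ) =
      (-Complex.I * z) ^ (-(d : ℂ) / 2) := by
    have hne : (-Complex.I * z).arg ≠ Real.pi := fun h ↦ by
      have := (Complex.arg_eq_pi_iff.mp h).1
      simp at this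
      linarith
    rw [neg_div, Complex.cpow_neg, ← Complex.inv_cpow _ _ hne]
    congr 1
    field_simp
  have hdual : -(Real.pi ^ 2 / -(Real.pi * Complex.I * z)) = Real.pi * Complex.I * -z⁻¹ := by
    field_simp
    simp
  have key := tsum_cexp_neg_mul_sum_mulVec_sq hA hb
  rw [hdual, hpow, neg_neg, Complex.ofReal_inv, hdet, mul_comm (((Aᵀ * A).det : ℂ) ^ _)] at key
  rw [hinv]
  simpa only [dotProduct_transpose_mul_self_mulVec] using key
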